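/- The function Card : ℙ → ℙ is not ({⊕, ⊗, ↓} ∪ 𝒫)-definable. -/

import Mathlib

noncomputable section
open Classical

/-- `s ⊕ t`: lifted addition on sets of naturals. -/
def setPlus (s t : Set ℕ) : Set ℕ := {u | ∃ m ∈ s, ∃ n ∈ t, u = m + n}

/-- `s ⊗ t`: lifted multiplication on sets of naturals. -/
def setTimes (s t : Set ℕ) : Set ℕ := {u | ∃ m ∈ s, ∃ n ∈ t, u = m * n}

/-- Sets of naturals definable by (variable-free) arithmetic circuits:
the smallest collection containing `∅`, `ℕ`, all singletons, closed under
union, intersection, complement, `⊕` and `⊗`. -/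
inductive ArithDefinable : Set ℕ → Prop
  | empty : ArithDefinable ∅
  | univ : ArithDefinable Set.univ
  | single (k : ℕ) : ArithDefinable {k}
  | union : ∀ {s t : Set ℕ}, ArithDefinable s → ArithDefinable t → ArithDefinable (s ∪ t)
  | inter : ∀ {s t : Set ℕ}, ArithDefinable s → ArithDefinable t → ArithDefinable (s ∩ t)
  | compl : ∀ {s : Set ℕ}, ArithDefinable s → ArithDefinable sᶜ
  | plus : ∀ {s t : Set ℕ}, ArithDefinable s → ArithDefinable t → ArithDefinable (setPlus s t)
  | times : ∀ {s t : Set ℕ}, ArithDefinable s → ArithDefinable t → ArithDefinable (setTimes s t)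

/-- A set-function of arity `k`. -/
abbrev SetFun (k : ℕ) := (Fin k → Set ℕ) → Set ℕ

/-- The `𝒪`-definable functions `ℙ^n → ℙ`, for a collection `O` of set-functions
(given per arity): smallest class containing projections and the constants
`∅`, `ℕ`, `{k}`, closed under pointwise union, intersection, complement, and
composition with functions in `O`. -/
inductive ODef (O : ∀ k, Set (SetFun k)) (n : ℕ) : SetFun n → Prop
  | proj (i : Fin n) : ODef O n (fun s => s i)
  | empty : ODef O n (fun _ => ∅)
  | univ : ODef O n (fun _ => Set.univ)
  | single (k : ℕ) : ODef O n (fun _ => {k})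
  | union : ∀ {F G : SetFun n}, ODef O n F → ODef O n G → ODef O n (fun s => F s ∪ G s)
  | inter : ∀ {F G : SetFun n}, ODef O n F → ODef O n G → ODef O n (fun s => F s ∩ G s)
  | compl : ∀ {F : SetFun n}, ODef O n F → ODef O n (fun s => (F s)ᶜ)
  | comp : ∀ {k : ℕ} {g : SetFun k} {F : Fin k → SetFun n},
      g ∈ O k → (∀ i, ODef O n (F i)) → ODef O n (fun s => g (fun i => F i s))

/-- `s_{|m} = s ∩ {0,…,m}`. -/
def restrict (s : Set ℕ) (m : ℕ) : Set ℕ := s ∩ {k | k ≤ m}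

/-- `F` is `h`-continuous on `D`. -/
def HCont (h : ℕ → ℕ) {n : ℕ} (F : SetFun n) (D : Set (Fin n → Set ℕ)) : Prop :=
  ∀ m : ℕ, ∀ s ∈ D, ∀ t ∈ D,
    (∀ i, restrict (s i) (h m) = restrict (t i) (h m)) →
    restrict (F s) m = restrict (F t) m

/-- `F` is uniformly continuous on `D`. -/
def UnifCont {n : ℕ} (F : SetFun n) (D : Set (Fin n → Set ℕ)) : Prop :=
  ∃ h : ℕ → ℕ, HCont h F D

/-- `𝒰`: set-functions (of arity `k`) uniformly continuous on the whole space. -/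
def Ucal (k : ℕ) : Set (SetFun k) := {g | UnifCont g Set.univ}

/-- `𝒫`: predicates, i.e. set-functions with values among `∅` and `{0}`. -/
def Pcal (k : ℕ) : Set (SetFun k) := {g | ∀ s, g s = ∅ ∨ g s = {0}}

/-- `𝒰 ∪ 𝒫`. -/
def UPcal (k : ℕ) : Set (SetFun k) := Ucal k ∪ Pcal k

/-- `Max(x)`. -/
def MaxFun (x : Set ℕ) : Set ℕ :=
  if x = ∅ then ∅ else if x.Infinite then Set.univ else {sSup x}

/-- `Card(x)`. -/
def CardFun (x : Set ℕ) : Set ℕ := if x.Finite then {x.ncard} else Set.univ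

/-- `↓(x)`. -/
def DownFun (x : Set ℕ) : Set ℕ := {m | ∃ n ∈ x, m ≤ n}

/-- `Sum(x)`. -/
def SumFun (x : Set ℕ) : Set ℕ := if x.Finite then {∑ᶠ n ∈ x, n} else Set.univ

/-- `Prod(x)`. -/
def ProdFun (x : Set ℕ) : Set ℕ := if x.Finite then {∏ᶠ n ∈ x, n} else Set.univ

/-- `Shove(x) = {n - min x : n ∈ x}` (empty for `x = ∅`). -/
def ShoveFun (x : Set ℕ) : Set ℕ := (fun n => n - sInf x) '' x

/-- `ε(x)`: the test for emptiness. -/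
def epsFun (x : Set ℕ) : Set ℕ := if x = ∅ then {0} else ∅

/-- `Fin(x)`: the test for finiteness. -/
def FinFun (x : Set ℕ) : Set ℕ := if x.Finite then {0} else ∅

/-- `⊕` as a set-function of arity 2. -/
def plusFun : SetFun 2 := fun s => setPlus (s 0) (s 1)

/-- `⊗` as a set-function of arity 2. -/
def timesFun : SetFun 2 := fun s => setTimes (s 0) (s 1)

/-- `↓` as a set-function of arity 1. -/
def downFun1 : SetFun 1 := fun s => DownFun (s 0)

/-- `ε` as a set-function of arity 1. -/
def epsFun1 : SetFun 1 := fun s => epsFun (s 0)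

/-- The collection `{⊕, ⊗}`. -/
def arithO : ∀ k, Set (SetFun k)
  | 2 => {plusFun, timesFun}
  | _ => ∅

/-- The collection `{⊕}`. -/
def addO : ∀ k, Set (SetFun k)
  | 2 => {plusFun}
  | _ => ∅

/-- The collection `{⊕, ↓} ∪ 𝒫`. -/
def addDownO : ∀ k, Set (SetFun k)
  | 1 => insert downFun1 (Pcal 1)
  | 2 => insert plusFun (Pcal 2)
  | k => Pcal k

/-- The collection `{⊕, ⊗, ↓} ∪ 𝒫`. -/
def arithDownO : ∀ k, Set (SetFun k)
  | 1 => insert downFun1 (Pcal 1)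
  | 2 => {plusFun, timesFun} ∪ Pcal 2
  | k => Pcal k

/-- The collection `𝒰 ∪ {ε}`. -/
def UEps : ∀ k, Set (SetFun k)
  | 1 => insert epsFun1 (Ucal 1)
  | k => Ucal k

/-- The collection `{⊕, ⊗} ∪ 𝒫`. -/
def arithPO (k : ℕ) : Set (SetFun k) := arithO k ∪ Pcal k

/-- A numerical function `ℕ → ℕ` is `O`-definable if some `O`-definable
set-function maps `{m}` to `{f m}` for every `m`. -/
def NumDef1 (O : ∀ k, Set (SetFun k)) (f : ℕ → ℕ) : Prop :=
  ∃ F : SetFun 1, ODef O 1 F ∧ ∀ m : ℕ, F (fun _ => {m}) = {f m}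

/-- A numerical function `ℕ^k → ℕ` is `O`-definable if some `O`-definable
set-function maps tuples of singletons to the corresponding singleton value. -/
def NumDef (O : ∀ k, Set (SetFun k)) (k : ℕ) (f : (Fin k → ℕ) → ℕ) : Prop :=
  ∃ F : SetFun k, ODef O k F ∧ ∀ m : Fin k → ℕ, F (fun i => ({m i} : Set ℕ)) = {f m}

/-- `f` is regressive: `{f n : f n < n}` is infinite. -/
def Regressive (f : ℕ → ℕ) : Prop := {y | ∃ n, f n = y ∧ y < n}.Infinite

/-- `f` is semi-regressive: for every `ℓ` there is `n` with `n + ℓ ≤ f n ≤ 2n - 2`. -/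
def SemiRegressive (f : ℕ → ℕ) : Prop :=
  ∀ ℓ : ℕ, ∃ n : ℕ, n + ℓ ≤ f n ∧ (f n : ℤ) ≤ 2 * (n : ℤ) - 2

/-- `F` has boundedly many traces: the number of initial segments `F s ∩ [0, k]`, for arguments `s`
that avoid `[0, k]`, is bounded independently of `k`. -/
def BoundedTraces {n : ℕ} (F : SetFun n) : Prop :=
  ∃ N : ℕ, ∀ k : ℕ, ∃ T : Finset (Set ℕ), T.card ≤ N ∧
    ∀ s : Fin n → Set ℕ, (∀ i, restrict (s i) k = ∅) → restrict (F s) k ∈ T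

theorem mem_restrict {s : Set ℕ} {m u : ℕ} : u ∈ restrict s m ↔ u ∈ s ∧ u ≤ m := Iff.rfl

theorem BoundedTraces.const {n : ℕ} (A : Set ℕ) : BoundedTraces (fun _ : Fin n → Set ℕ => A) :=
  ⟨1, fun k => ⟨{restrict A k}, by simp, fun s _ => by simp⟩⟩

theorem BoundedTraces.proj {n : ℕ} (i : Fin n) :
    BoundedTraces (fun s : Fin n → Set ℕ => s i) :=
  ⟨1, fun k => ⟨{∅}, by simp, fun s hs => by simp [hs i]⟩⟩

/-- Bounded traces are preserved by any operation whose trace is determined by the traces of its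
arguments together with a parameter from a fixed finite type. -/
theorem BoundedTraces.map₂ {ι : Type*} [Fintype ι] {n : ℕ} {F G : SetFun n}
    (hF : BoundedTraces F) (hG : BoundedTraces G) (op : Set ℕ → Set ℕ → Set ℕ)
    (φ : ℕ → ι → Set ℕ → Set ℕ → Set ℕ)
    (h : ∀ k A B, ∃ e, restrict (op A B) k = φ k e (restrict A k) (restrict B k)) :
    BoundedTraces (fun s => op (F s) (G s)) := by
  obtain ⟨N, hN⟩ := hF
  obtain ⟨M, hM⟩ := hG
  refine ⟨Fintype.card ι * (N * M), fun k => ?_⟩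
  obtain ⟨T, hT, hFT⟩ := hN k
  obtain ⟨U, hU, hGU⟩ := hM k
  refine ⟨((Finset.univ : Finset ι) ×ˢ T ×ˢ U).image fun p => φ k p.1 p.2.1 p.2.2,
    Finset.card_image_le.trans ?_, fun s hs => ?_⟩
  · rw [Finset.card_product, Finset.card_product, Finset.card_univ]
    gcongr
  · obtain ⟨e, he⟩ := h k (F s) (G s)
    refine Finset.mem_image.2 ⟨(e, restrict (F s) k, restrict (G s) k), ?_, he.symm⟩
    simp [hFT s hs, hGU s hs]

theorem BoundedTraces.union {n : ℕ} {F G : SetFun n} (hF : BoundedTraces F)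
    (hG : BoundedTraces G) : BoundedTraces (fun s => F s ∪ G s) :=
  hF.map₂ hG (· ∪ ·) (fun _ (_ : Unit) A B => A ∪ B)
    fun _ _ _ => ⟨(), Set.union_inter_distrib_right _ _ _⟩

theorem BoundedTraces.inter {n : ℕ} {F G : SetFun n} (hF : BoundedTraces F)
    (hG : BoundedTraces G) : BoundedTraces (fun s => F s ∩ G s) :=
  hF.map₂ hG (· ∩ ·) (fun _ (_ : Unit) A B => A ∩ B)
    fun _ _ _ => ⟨(), Set.inter_inter_distrib_right _ _ _⟩

theorem BoundedTraces.compl {n : ℕ} {F : SetFun n} (hF : BoundedTraces F) :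
    BoundedTraces (fun s => (F s)ᶜ) := by
  refine hF.map₂ hF (fun A _ => Aᶜ) (fun k (_ : Unit) A _ => restrict Aᶜ k)
    fun k A _ => ⟨(), ?_⟩
  ext u
  simp only [mem_restrict, Set.mem_compl_iff]
  tauto

theorem BoundedTraces.setPlus {n : ℕ} {F G : SetFun n} (hF : BoundedTraces F)
    (hG : BoundedTraces G) : BoundedTraces (fun s => setPlus (F s) (G s)) := by
  refine hF.map₂ hG _root_.setPlus (fun k (_ : Unit) A B => restrict (_root_.setPlus A B) k)
    fun k A B => ⟨(), ?_⟩
  ext u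
  constructor
  · rintro ⟨⟨a, ha, b, hb, rfl⟩, hk : a + b ≤ k⟩
    exact ⟨⟨a, ⟨ha, (by omega : a ≤ k)⟩, b, ⟨hb, (by omega : b ≤ k)⟩, rfl⟩, hk⟩
  · rintro ⟨⟨a, ha, b, hb, rfl⟩, hk⟩
    exact ⟨⟨a, ha.1, b, hb.1, rfl⟩, hk⟩

/-- Whether `0` lies in a product cannot be read off from the traces of the factors, so it is
the parameter. -/
theorem BoundedTraces.setTimes {n : ℕ} {F G : SetFun n} (hF : BoundedTraces F)
    (hG : BoundedTraces G) : BoundedTraces (fun s => setTimes (F s) (G s)) := by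
  refine hF.map₂ hG _root_.setTimes
    (fun k (e : Prop) A B => {u | u ≤ k ∧ (u = 0 ∧ e ∨ u ≠ 0 ∧ u ∈ _root_.setTimes A B)})
    fun k A B => ⟨0 ∈ _root_.setTimes A B, ?_⟩
  ext u
  constructor
  · rintro ⟨hu, hk : u ≤ k⟩
    refine ⟨hk, ?_⟩
    rcases eq_or_ne u 0 with rfl | h0
    · exact Or.inl ⟨rfl, hu⟩
    · refine Or.inr ⟨h0, ?_⟩
      obtain ⟨a, ha, b, hb, rfl⟩ := hu
      have ha0 : 0 < a := Nat.pos_of_ne_zero (left_ne_zero_of_mul h0)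
      have hb0 : 0 < b := Nat.pos_of_ne_zero (right_ne_zero_of_mul h0)
      exact ⟨a, ⟨ha, (Nat.le_mul_of_pos_right a hb0).trans hk⟩,
        b, ⟨hb, (Nat.le_mul_of_pos_left b ha0).trans hk⟩, rfl⟩
  · rintro ⟨hk, ⟨rfl, hu⟩ | ⟨-, a, ha, b, hb, rfl⟩⟩
    · exact ⟨hu, hk⟩
    · exact ⟨⟨a, ha.1, b, hb.1, rfl⟩, hk⟩

theorem BoundedTraces.downFun {n : ℕ} {F : SetFun n} (hF : BoundedTraces F) :
    BoundedTraces (fun s => DownFun (F s)) := by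
  refine hF.map₂ hF (fun A _ => DownFun A)
    (fun k (e : Prop) A _ => {u | u ≤ k ∧ (e ∨ u ∈ DownFun A)})
    fun k A _ => ⟨∃ a ∈ A, k < a, ?_⟩
  ext u
  constructor
  · rintro ⟨⟨a, ha, hua⟩, hk⟩
    refine ⟨hk, ?_⟩
    by_cases hak : a ≤ k
    · exact Or.inr ⟨a, ⟨ha, hak⟩, hua⟩
    · exact Or.inl ⟨a, ha, not_le.1 hak⟩
  · rintro ⟨hk, ⟨a, ha, hka⟩ | ⟨a, ha, hua⟩⟩
    · exact ⟨⟨a, ha, hk.trans hka.le⟩, hk⟩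
    · exact ⟨⟨a, ha.1, hua⟩, hk⟩

theorem BoundedTraces.of_mem_Pcal {n k : ℕ} {g : SetFun k} (hg : g ∈ Pcal k)
    (F : Fin k → SetFun n) : BoundedTraces (fun s => g fun i => F i s) := by
  refine ⟨2, fun m => ⟨{restrict ∅ m, restrict {0} m}, Finset.card_le_two, fun s _ => ?_⟩⟩
  rcases hg fun i => F i s with h | h <;> simp [h]

theorem ODef.boundedTraces {n : ℕ} {F : SetFun n} (hF : ODef arithDownO n F) :
    BoundedTraces F := by
  induction hF with
  | proj i => exact .proj i
  | empty => exact .const ∅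
  | univ => exact .const Set.univ
  | single k => exact .const {k}
  | union _ _ ihF ihG => exact ihF.union ihG
  | inter _ _ ihF ihG => exact ihF.inter ihG
  | compl _ ih => exact ih.compl
  | @comp k g F hg _ ih =>
    match k, g, F, hg, ih with
    | 0, _, F, hg, _ => exact .of_mem_Pcal hg F
    | 1, _, _, Or.inl rfl, ih => exact (ih 0).downFun
    | 1, _, F, Or.inr hg, _ => exact .of_mem_Pcal hg F
    | 2, _, _, Or.inl (Or.inl rfl), ih => exact (ih 0).setPlus (ih 1)
    | 2, _, _, Or.inl (Or.inr rfl), ih => exact (ih 0).setTimes (ih 1)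
    | 2, _, F, Or.inr hg, _ => exact .of_mem_Pcal hg F
    | _ + 3, _, F, hg, _ => exact .of_mem_Pcal hg F

theorem not_boundedTraces_cardFun :
    ¬ BoundedTraces (fun v : Fin 1 → Set ℕ => CardFun (v 0)) := by
  rintro ⟨N, hN⟩
  obtain ⟨T, hT, h⟩ := hN N
  have hmem : ∀ c ∈ Finset.range (N + 1), ({c} : Set ℕ) ∈ T := by
    intro c hc
    have hcN : c ≤ N := Finset.mem_range_succ_iff.1 hc
    have hs := h (fun _ => (Finset.Ioc N (N + c) : Finset ℕ)) fun _ =>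
      Set.eq_empty_of_forall_notMem fun u hu => (Finset.mem_Ioc.1 hu.1).1.not_ge hu.2
    have hcard : CardFun (Finset.Ioc N (N + c) : Finset ℕ) = {c} := by
      rw [CardFun, if_pos (Finset.finite_toSet _), Set.ncard_coe_finset, Nat.card_Ioc,
        Nat.add_sub_cancel_left]
    have hres : restrict {c} N = {c} :=
      Set.inter_eq_left.2 (Set.singleton_subset_iff.2 hcN)
    simpa only [hcard, hres] using hs
  have hle := Finset.card_le_card_of_injOn (fun c : ℕ => ({c} : Set ℕ)) hmem
    (Set.singleton_injective.injOn)
  rw [Finset.card_range] at hle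
  omega

theorem card_not_arithDown_definable :
    ¬ ODef arithDownO 1 (fun v => CardFun (v 0)) :=
  fun h => not_boundedTraces_cardFun h.boundedTraces

end
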